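/- For every group G there exists a projective plane P whose full automorphism group is isomorphic to G; here the automorphism group of P is the group, under componentwise composition, of all pairs (σ, τ) where σ is a bijection of the points of P and τ is a bijection of the lines of P such that a point p is incident with a line M if and only if σ(p) is incident with τ(M). -/

import Mathlib

universe u

/-- A point-line incidence relation `I` is a projective plane if any two distinct
points lie on a unique common line, any two distinct lines meet in a unique point,
and there exist four points no three of which are incident with a common line. -/
structure IsProjectivePlane {P L : Type*} (I : P → L → Prop) : Prop where
  line_unique : ∀ p q : P, p ≠ q → ∃! M : L, I p M ∧ I q M
  point_unique : ∀ M N : L, M ≠ N → ∃! p : P, I p M ∧ I p N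
  nondeg : ∃ a b c d : P, a ≠ b ∧ a ≠ c ∧ a ≠ d ∧ b ≠ c ∧ b ≠ d ∧ c ≠ d ∧
    ∀ M : L, ¬(I a M ∧ I b M ∧ I c M) ∧ ¬(I a M ∧ I b M ∧ I d M) ∧
      ¬(I a M ∧ I c M ∧ I d M) ∧ ¬(I b M ∧ I c M ∧ I d M)

/-- The full automorphism group of a point-line incidence structure: all pairs
`(σ, τ)` of a bijection `σ` of the points and a bijection `τ` of the lines such that
`p` is incident with `M` if and only if `σ p` is incident with `τ M`, under
componentwise composition. -/
def autGroup {P L : Type*} (I : P → L → Prop) : Subgroup (Equiv.Perm P × Equiv.Perm L) where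
  carrier := {στ | ∀ (p : P) (M : L), I p M ↔ I (στ.1 p) (στ.2 M)}
  one_mem' := fun _ _ => Iff.rfl
  mul_mem' := by
    intro a b ha hb p M
    exact (hb p M).trans (ha _ _)
  inv_mem' := by
    intro a ha p M
    have := ha (a.1⁻¹ p) (a.2⁻¹ M)
    simpa using this.symm

namespace FreePlane

/-- Commutative binary terms over `B`, before identifying `pair x y` with `pair y x`. -/
inductive T (B : Type u) : Type u
  | base : B → T B
  | pair : T B → T B → T B

/-- Equality of terms up to commutativity. -/
inductive R {B : Type u} : T B → T B → Prop
  | base (b : B) : R (T.base b) (T.base b)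
  | cong {a b c d : T B} : R a c → R b d → R (T.pair a b) (T.pair c d)
  | swap {a b c d : T B} : R a d → R b c → R (T.pair a b) (T.pair c d)

theorem R.refl {B : Type u} (x : T B) : R x x := by
  induction x with
  | base b => exact R.base b
  | pair x y hx hy => exact R.cong hx hy

theorem R.symm {B : Type u} {x y : T B} (h : R x y) : R y x := by
  induction h with
  | base b => exact R.base b
  | cong _ _ h1 h2 => exact R.cong h1 h2
  | swap _ _ h1 h2 => exact R.swap h2 h1

theorem R.trans {B : Type u} {x y z : T B} (h : R x y) (h2 : R y z) : R x z := by
  induction h generalizing z with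
  | base b => exact h2
  | cong _ _ i1 i2 =>
    cases h2 with
    | cong k1 k2 => exact R.cong (i1 k1) (i2 k2)
    | swap k1 k2 => exact R.swap (i1 k1) (i2 k2)
  | swap _ _ i1 i2 =>
    cases h2 with
    | cong k1 k2 => exact R.swap (i1 k2) (i2 k1)
    | swap k1 k2 => exact R.cong (i1 k2) (i2 k1)

instance setoidT (B : Type u) : Setoid (T B) := ⟨R, R.refl, R.symm, R.trans⟩

/-- Commutative terms. -/
def Q (B : Type u) : Type u := Quotient (setoidT B)

namespace Q
variable {B : Type u}

def base (b : B) : Q B := Quotient.mk _ (T.base b)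

def pair (x y : Q B) : Q B :=
  Quotient.map₂ T.pair (fun _ _ h1 _ _ h2 => R.cong h1 h2) x y

theorem pair_comm (x y : Q B) : pair x y = pair y x := by
  induction x using Quotient.inductionOn
  induction y using Quotient.inductionOn
  exact Quotient.sound (R.swap (R.refl _) (R.refl _))

theorem ind {p : Q B → Prop} (hb : ∀ b, p (base b)) (hp : ∀ x y, p x → p y → p (pair x y))
    (x : Q B) : p x := by
  induction x using Quotient.inductionOn with
  | h t =>
    induction t with
    | base b => exact hb b
    | pair s t hs ht => exact hp _ _ hs ht

theorem base_inj {a b : B} (h : base a = base b) : a = b := by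
  have h : R (T.base a) (T.base b) := Quotient.exact h
  cases h
  rfl

theorem base_ne_pair (b : B) (x y : Q B) : base b ≠ pair x y := by
  induction x using Quotient.inductionOn
  induction y using Quotient.inductionOn
  intro h
  have h : R (T.base b) (T.pair _ _) := Quotient.exact h
  cases h

theorem pair_inj {x y z w : Q B} (h : pair x y = pair z w) :
    (x = z ∧ y = w) ∨ (x = w ∧ y = z) := by
  induction x using Quotient.inductionOn
  induction y using Quotient.inductionOn
  induction z using Quotient.inductionOn
  induction w using Quotient.inductionOn
  have h : R (T.pair _ _) (T.pair _ _) := Quotient.exact h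
  cases h with
  | cong h1 h2 => exact Or.inl ⟨Quotient.sound h1, Quotient.sound h2⟩
  | swap h1 h2 => exact Or.inr ⟨Quotient.sound h1, Quotient.sound h2⟩

def sizeT : T B → ℕ
  | T.base _ => 0
  | T.pair x y => sizeT x + sizeT y + 1

def size (x : Q B) : ℕ := Quotient.lift sizeT (by
  intro a b h
  replace h : R a b := h
  induction h with
  | base b => rfl
  | cong _ _ h1 h2 => simp [sizeT, h1, h2]
  | swap _ _ h1 h2 => simp [sizeT, h1, h2, Nat.add_comm]) x

theorem size_base (b : B) : size (base b) = 0 := rfl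
theorem size_pair (x y : Q B) : size (pair x y) = size x + size y + 1 := by
  induction x using Quotient.inductionOn
  induction y using Quotient.inductionOn
  rfl

def colT (c : B → Bool) : T B → Bool
  | T.base b => c b
  | T.pair x y => !(colT c x && colT c y)

def col (c : B → Bool) (x : Q B) : Bool := Quotient.lift (colT c) (by
  intro a b h
  replace h : R a b := h
  induction h with
  | base b => rfl
  | cong _ _ h1 h2 => simp [colT, h1, h2]
  | swap _ _ h1 h2 => simp [colT, h1, h2, Bool.or_comm]) x

theorem col_base (c : B → Bool) (b : B) : col c (base b) = c b := rfl
theorem col_pair (c : B → Bool) (x y : Q B) : col c (pair x y) = !(col c x && col c y) := by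
  induction x using Quotient.inductionOn
  induction y using Quotient.inductionOn
  rfl

def mapT (f : B → B) : T B → T B
  | T.base b => T.base (f b)
  | T.pair x y => T.pair (mapT f x) (mapT f y)

def map (f : B → B) (x : Q B) : Q B := Quotient.map (mapT f) (by
  intro a b h
  replace h : R a b := h
  show R _ _
  induction h with
  | base b => exact R.base _
  | cong _ _ h1 h2 => exact R.cong h1 h2
  | swap _ _ h1 h2 => exact R.swap h1 h2) x

theorem map_base (f : B → B) (b : B) : map f (base b) = base (f b) := rfl
theorem map_pair (f : B → B) (x y : Q B) : map f (pair x y) = pair (map f x) (map f y) := by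
  induction x using Quotient.inductionOn
  induction y using Quotient.inductionOn
  rfl

theorem map_id (x : Q B) : map id x = x := by
  induction x using ind with
  | hb b => rfl
  | hp x y hx hy => rw [map_pair, hx, hy]

theorem map_comp (f g : B → B) (x : Q B) : map (f ∘ g) x = map f (map g x) := by
  induction x using ind with
  | hb b => rfl
  | hp x y hx hy => rw [map_pair, hx, hy, map_pair, map_pair]

theorem size_eq_zero {x : Q B} (h : size x = 0) : ∃ b, x = base b := by
  induction x using ind with
  | hb b => exact ⟨b, rfl⟩
  | hp x y hx hy => rw [size_pair] at h; omega

end Q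

open Q

/-- The hypotheses on the base configuration. -/
structure GoodBase {B : Type u} (c : B → Bool) (adj : B → B → Prop) : Prop where
  symm : ∀ {x y}, adj x y → adj y x
  col_ne : ∀ {x y}, adj x y → c x ≠ c y
  c4 : ∀ {a b x y}, adj a x → adj a y → adj b x → adj b y → a = b ∨ x = y
  conf : ∀ b, ∃ S : Set B, S.Finite ∧ b ∈ S ∧ ∀ x ∈ S, ∃ y₁ ∈ S, ∃ y₂ ∈ S, ∃ y₃ ∈ S,
    y₁ ≠ y₂ ∧ y₁ ≠ y₃ ∧ y₂ ≠ y₃ ∧ adj x y₁ ∧ adj x y₂ ∧ adj x y₃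
  quad : ∃ p q r s l m : B, c p = false ∧ c q = false ∧ c r = false ∧ c s = false ∧
    p ≠ q ∧ r ≠ s ∧ adj p l ∧ adj q l ∧ ¬ adj r l ∧ ¬ adj s l ∧
    adj r m ∧ adj s m ∧ ¬ adj p m ∧ ¬ adj q m

section
variable {B : Type u} (c : B → Bool) (adj : B → B → Prop)

/-- Adjacency of terms. -/
def Adj (x y : Q B) : Prop :=
  (∃ a b, x = base a ∧ y = base b ∧ adj a b) ∨ (∃ z, x = pair y z) ∨ (∃ z, y = pair x z)

/-- The terms that are elements of the free completion. -/
inductive Valid : Q B → Prop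
  | base (b : B) : Valid (base b)
  | pair (x y : Q B) : Valid x → Valid y → x ≠ y → col c x = col c y →
      (∀ z, Adj adj x z → Adj adj y z → z = Q.pair x y) → Valid (Q.pair x y)

variable {c adj}

theorem Adj.base_iff {a b : B} : Adj adj (base a) (base b) ↔ adj a b := by
  constructor
  · rintro (⟨a', b', h1, h2, h⟩ | ⟨z, h⟩ | ⟨z, h⟩)
    · rw [base_inj h1, base_inj h2]; exact h
    · exact absurd h (base_ne_pair _ _ _)
    · exact absurd h (base_ne_pair _ _ _)
  · intro h; exact Or.inl ⟨a, b, rfl, rfl, h⟩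

theorem Adj.symm (hB : GoodBase c adj) {x y : Q B} (h : Adj adj x y) : Adj adj y x := by
  rcases h with ⟨a, b, h1, h2, h⟩ | h | h
  · exact Or.inl ⟨b, a, h2, h1, hB.symm h⟩
  · exact Or.inr (Or.inr h)
  · exact Or.inr (Or.inl h)

theorem Valid.inv {x y : Q B} (h : Valid c adj (Q.pair x y)) :
    Valid c adj x ∧ Valid c adj y ∧ x ≠ y ∧ col c x = col c y ∧
      (∀ z, Adj adj x z → Adj adj y z → z = Q.pair x y) := by
  generalize hq : Q.pair x y = q at h
  cases h with
  | base b => exact absurd hq.symm (base_ne_pair _ _ _)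
  | pair x' y' hx hy hne hc hz =>
    rcases pair_inj hq with ⟨rfl, rfl⟩ | ⟨rfl, rfl⟩
    · exact ⟨hx, hy, hne, hc, hz⟩
    · exact ⟨hy, hx, hne.symm, hc.symm, fun z h1 h2 => hz z h2 h1⟩

theorem Adj.col_ne (hB : GoodBase c adj) {x y : Q B} (hx : Valid c adj x) (hy : Valid c adj y)
    (h : Adj adj x y) : col c x ≠ col c y := by
  rcases h with ⟨a, b, rfl, rfl, h⟩ | ⟨z, rfl⟩ | ⟨z, rfl⟩
  · exact hB.col_ne h
  · rw [col_pair, hx.inv.2.2.2.1]; cases col c z <;> simp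
  · rw [col_pair, hy.inv.2.2.2.1]; cases col c z <;> simp

theorem valid_common {a b z : Q B} (ha : Valid c adj a) (hb : Valid c adj b) (hab : a ≠ b)
    (h1 : Adj adj a z) (h2 : Adj adj b z) (hz : z ≠ Q.pair a b) : Valid c adj z := by
  rcases h1 with ⟨a', z', rfl, rfl, h⟩ | ⟨w, rfl⟩ | ⟨w, rfl⟩
  · exact Valid.base _
  · exact ha.inv.1
  · rcases h2 with ⟨a', z', _, h, _⟩ | ⟨w', rfl⟩ | ⟨w', h⟩
    · exact absurd h.symm (base_ne_pair _ _ _)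
    · exact hb.inv.1
    · rcases pair_inj h with ⟨h, _⟩ | ⟨_, h⟩
      · exact absurd h hab
      · exact absurd (by rw [h]) hz

theorem exists_common {a b : Q B} (ha : Valid c adj a) (hb : Valid c adj b) (hab : a ≠ b)
    (hc : col c a = col c b) : ∃ z, Valid c adj z ∧ Adj adj a z ∧ Adj adj b z := by
  by_cases h : ∃ z, Adj adj a z ∧ Adj adj b z ∧ z ≠ Q.pair a b
  · obtain ⟨z, h1, h2, h3⟩ := h
    exact ⟨z, valid_common ha hb hab h1 h2 h3, h1, h2⟩
  · push Not at h
    exact ⟨_, Valid.pair a b ha hb hab hc h, Or.inr (Or.inr ⟨b, rfl⟩),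
      Or.inr (Or.inr ⟨a, pair_comm _ _⟩)⟩

theorem child {m p : Q B} (h : Adj adj m p) (hs : size p ≤ size m) (hm : size m ≠ 0) :
    ∃ w, m = Q.pair p w := by
  rcases h with ⟨a', z', rfl, rfl, h⟩ | h | ⟨w, rfl⟩
  · exact absurd rfl hm
  · exact h
  · rw [size_pair] at hs; omega

theorem unique_of_max (hB : GoodBase c adj) {a b x y : Q B} (ha : Valid c adj a)
    (h1 : Adj adj a x) (h2 : Adj adj a y) (h3 : Adj adj b x) (h4 : Adj adj b y)
    (hb : size b ≤ size a) (hx : size x ≤ size a) (hy : size y ≤ size a) : a = b ∨ x = y := by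
  by_cases h0 : size a = 0
  · obtain ⟨a, rfl⟩ := size_eq_zero h0
    obtain ⟨b, rfl⟩ := size_eq_zero (x := b) (by omega)
    obtain ⟨x, rfl⟩ := size_eq_zero (x := x) (by omega)
    obtain ⟨y, rfl⟩ := size_eq_zero (x := y) (by omega)
    rw [Adj.base_iff] at h1 h2 h3 h4
    rcases hB.c4 h1 h2 h3 h4 with h | h
    · exact Or.inl (by rw [h])
    · exact Or.inr (by rw [h])
  · by_cases hxy : x = y
    · exact Or.inr hxy
    left
    obtain ⟨w, rfl⟩ := child h1 hx h0
    obtain ⟨w', h⟩ := child h2 hy h0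
    rcases pair_inj h with ⟨h, _⟩ | ⟨_, h⟩
    · exact absurd h hxy
    · subst h
      exact (ha.inv.2.2.2.2 b (h3.symm hB) (h4.symm hB)).symm

theorem unique (hB : GoodBase c adj) {a b x y : Q B} (ha : Valid c adj a) (hb : Valid c adj b)
    (hx : Valid c adj x) (hy : Valid c adj y)
    (h1 : Adj adj a x) (h2 : Adj adj a y) (h3 : Adj adj b x) (h4 : Adj adj b y) :
    a = b ∨ x = y := by
  have ca := fun u v w => unique_of_max hB ha h1 h2 h3 h4 u v w
  have cb := fun u v w => unique_of_max hB hb h3 h4 h1 h2 u v w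
  have cx := fun u v w => unique_of_max hB hx (h1.symm hB) (h3.symm hB) (h2.symm hB)
    (h4.symm hB) u v w
  have cy := fun u v w => unique_of_max hB hy (h2.symm hB) (h4.symm hB) (h1.symm hB)
    (h3.symm hB) u v w
  have : (size b ≤ size a ∧ size x ≤ size a ∧ size y ≤ size a) ∨
    (size a ≤ size b ∧ size x ≤ size b ∧ size y ≤ size b) ∨
    (size y ≤ size x ∧ size a ≤ size x ∧ size b ≤ size x) ∨
    (size x ≤ size y ∧ size a ≤ size y ∧ size b ≤ size y) := by omega
  rcases this with ⟨u, v, w⟩ | ⟨u, v, w⟩ | ⟨u, v, w⟩ | ⟨u, v, w⟩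
  · exact ca u v w
  · exact (cb u v w).imp_left Eq.symm
  · exact (cx u v w).symm
  · exact (cy u v w).symm.imp_right Eq.symm

/-- Membership in a finite confined configuration, inside a graph. -/
def Conf {X : Type u} (adj : X → X → Prop) (b : X) : Prop :=
  ∃ S : Set X, S.Finite ∧ b ∈ S ∧ ∀ x ∈ S, ∃ y₁ ∈ S, ∃ y₂ ∈ S, ∃ y₃ ∈ S,
    y₁ ≠ y₂ ∧ y₁ ≠ y₃ ∧ y₂ ≠ y₃ ∧ adj x y₁ ∧ adj x y₂ ∧ adj x y₃

theorem Conf.map {X Y : Type u} {adj : X → X → Prop} {adj' : Y → Y → Prop} (f : X → Y)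
    (hf : Function.Injective f) (h : ∀ x y, adj x y → adj' (f x) (f y)) {b : X}
    (hb : Conf adj b) : Conf adj' (f b) := by
  obtain ⟨S, hS, hbS, hh⟩ := hb
  refine ⟨Set.image f S, hS.image f, ⟨b, hbS, rfl⟩, ?_⟩
  rintro _ ⟨x, hx, rfl⟩
  obtain ⟨y₁, m₁, y₂, m₂, y₃, m₃, n₁, n₂, n₃, a₁, a₂, a₃⟩ := hh x hx
  exact ⟨f y₁, ⟨_, m₁, rfl⟩, f y₂, ⟨_, m₂, rfl⟩, f y₃, ⟨_, m₃, rfl⟩, hf.ne n₁, hf.ne n₂, hf.ne n₃,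
    h _ _ a₁, h _ _ a₂, h _ _ a₃⟩

variable (c adj) in
/-- The elements of the free completion. -/
abbrev F : Type u := {q : Q B // Valid c adj q}

def fadj (x y : F c adj) : Prop := Adj adj x.1 y.1

def fbase (b : B) : F c adj := ⟨base b, Valid.base b⟩

theorem conf_iff (hB : GoodBase c adj) (x : F c adj) :
    Conf fadj x ↔ ∃ b, x = fbase b := by
  constructor
  · rintro ⟨S, hS, hb, hh⟩
    obtain ⟨m, hm, hmax⟩ := Set.exists_max_image S (fun y => size y.1) hS ⟨x, hb⟩
    have h0 : size m.1 = 0 := by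
      by_contra h0
      obtain ⟨y₁, m₁, y₂, m₂, y₃, m₃, n₁, n₂, n₃, a₁, a₂, a₃⟩ := hh m hm
      obtain ⟨w₁, e₁⟩ := child a₁ (hmax _ m₁) h0
      obtain ⟨w₂, e₂⟩ := child a₂ (hmax _ m₂) h0
      obtain ⟨w₃, e₃⟩ := child a₃ (hmax _ m₃) h0
      have n₁ : y₁.1 ≠ y₂.1 := fun h => n₁ (Subtype.ext h)
      have n₂ : y₁.1 ≠ y₃.1 := fun h => n₂ (Subtype.ext h)
      have n₃ : y₂.1 ≠ y₃.1 := fun h => n₃ (Subtype.ext h)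
      rcases pair_inj (e₁.symm.trans e₂) with ⟨h, _⟩ | ⟨_, h⟩
      · exact n₁ h
      rcases pair_inj (e₁.symm.trans e₃) with ⟨h', _⟩ | ⟨_, h'⟩
      · exact n₂ h'
      exact n₃ (h.symm.trans h')
    have h1 : size x.1 ≤ size m.1 := hmax x hb
    obtain ⟨b, hb⟩ := size_eq_zero (x := x.1) (by omega)
    exact ⟨b, Subtype.ext hb⟩
  · rintro ⟨b, rfl⟩
    exact Conf.map fbase (fun a b h => base_inj (congrArg Subtype.val h))
      (fun x y h => Adj.base_iff.2 h) (hB.conf b)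

/-- Automorphisms of the base act on terms. -/
theorem adj_map {f : B → B} (hf : ∀ x y, adj x y → adj (f x) (f y)) {x y : Q B}
    (h : Adj adj x y) : Adj adj (map f x) (map f y) := by
  rcases h with ⟨a, b, rfl, rfl, h⟩ | ⟨z, rfl⟩ | ⟨z, rfl⟩
  · exact Or.inl ⟨_, _, rfl, rfl, hf _ _ h⟩
  · exact Or.inr (Or.inl ⟨map f z, map_pair _ _ _⟩)
  · exact Or.inr (Or.inr ⟨map f z, map_pair _ _ _⟩)

theorem col_map {f : B → B} (hf : ∀ x, c (f x) = c x) (x : Q B) :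
    col c (map f x) = col c x := by
  induction x using ind with
  | hb b => exact hf b
  | hp x y hx hy => rw [map_pair, col_pair, col_pair, hx, hy]

theorem map_perm_inv (f : Equiv.Perm B) (x : Q B) : map f (map (f⁻¹ : Equiv.Perm B) x) = x := by
  rw [← map_comp]
  have : (f ∘ (f⁻¹ : Equiv.Perm B)) = id := by ext; simp
  rw [this, map_id]

theorem valid_map {f : Equiv.Perm B} (hf : ∀ x y, adj x y ↔ adj (f x) (f y))
    (hc : ∀ x, c (f x) = c x) {x : Q B}
    (h : Valid c adj x) : Valid c adj (map f x) := by
  have hf2 : ∀ x y, adj x y → adj ((f⁻¹ : Equiv.Perm B) x) ((f⁻¹ : Equiv.Perm B) y) := by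
    intro x y h
    rw [hf]; simpa using h
  have hinv : ∀ x : Q B, map (f⁻¹ : Equiv.Perm B) (map f x) = x := by
    intro x
    have := map_perm_inv f⁻¹ x
    rwa [inv_inv] at this
  induction h with
  | base b => exact Valid.base _
  | pair x y hx hy hne hcol hz ihx ihy =>
    rw [map_pair]
    refine Valid.pair _ _ ihx ihy ?_ ?_ ?_
    · intro h
      apply hne
      rw [← hinv x, h, hinv]
    · rw [col_map hc, col_map hc, hcol]
    · intro z h1 h2
      have h1 := adj_map hf2 h1
      have h2 := adj_map hf2 h2
      rw [hinv] at h1 h2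
      have := hz _ h1 h2
      rw [← map_pair, ← this, map_perm_inv]

end

end FreePlane

namespace FreePlane
open Q

section
variable {B : Type u} {c : B → Bool} {adj : B → B → Prop} {G : Type u} [Group G]

/-- The action of `G` on the free completion. -/
def actF (ρ : G →* Equiv.Perm B) (hadj : ∀ g x y, adj x y ↔ adj (ρ g x) (ρ g y))
    (hcol : ∀ g x, c (ρ g x) = c x) : G →* Equiv.Perm (F c adj) where
  toFun g :=
    { toFun := fun x => ⟨map (ρ g) x.1, valid_map (hadj g) (hcol g) x.2⟩
      invFun := fun x => ⟨map (ρ g⁻¹) x.1, valid_map (hadj g⁻¹) (hcol g⁻¹) x.2⟩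
      left_inv := fun x => Subtype.ext (by
        have := map_perm_inv (ρ g⁻¹) x.1
        rwa [← map_inv, inv_inv] at this)
      right_inv := fun x => Subtype.ext (by
        have := map_perm_inv (ρ g) x.1
        rwa [← map_inv] at this) }
  map_one' := by
    apply Equiv.ext
    intro x
    apply Subtype.ext
    show map (ρ 1) x.1 = x.1
    rw [map_one]
    exact map_id _
  map_mul' g h := by
    apply Equiv.ext
    intro x
    apply Subtype.ext
    show map (ρ (g * h)) x.1 = map (ρ g) (map (ρ h) x.1)
    rw [map_mul, ← map_comp]
    rfl

theorem actF_val (ρ : G →* Equiv.Perm B) (hadj : ∀ g x y, adj x y ↔ adj (ρ g x) (ρ g y))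
    (hcol : ∀ g x, c (ρ g x) = c x) (g : G) (x : F c adj) :
    (actF ρ hadj hcol g x).1 = map (ρ g) x.1 := rfl

variable (c adj) in
def isPt (x : F c adj) : Prop := col c x.1 = false

instance : DecidablePred (isPt c adj) := fun x => inferInstanceAs (Decidable (col c x.1 = false))

variable (c adj) in
def inc (p : {x : F c adj // isPt c adj x}) (l : {x : F c adj // ¬ isPt c adj x}) : Prop :=
  fadj p.1 l.1

theorem plane (hB : GoodBase c adj) : IsProjectivePlane (inc c adj) where
  line_unique p q hpq := by
    have hne : p.1.1 ≠ q.1.1 := fun h => hpq (Subtype.ext (Subtype.ext h))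
    obtain ⟨z, hz, h1, h2⟩ := exists_common p.1.2 q.1.2 hne
      ((show _ = false from p.2).trans (show _ = false from q.2).symm)
    refine ⟨⟨⟨z, hz⟩, ?_⟩, ⟨h1, h2⟩, ?_⟩
    · intro h
      exact h1.col_ne hB p.1.2 hz ((show _ = false from p.2).trans h.symm)
    · rintro y ⟨k1, k2⟩
      rcases unique hB p.1.2 q.1.2 y.1.2 hz k1 h1 k2 h2 with h | h
      · exact absurd h hne
      · exact Subtype.ext (Subtype.ext h)
  point_unique p q hpq := by
    have hne : p.1.1 ≠ q.1.1 := fun h => hpq (Subtype.ext (Subtype.ext h))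
    have hp : col c p.1.1 = true := by simpa [isPt] using p.2
    have hq : col c q.1.1 = true := by simpa [isPt] using q.2
    obtain ⟨z, hz, h1, h2⟩ := exists_common p.1.2 q.1.2 hne (hp.trans hq.symm)
    refine ⟨⟨⟨z, hz⟩, ?_⟩, ⟨h1.symm hB, h2.symm hB⟩, ?_⟩
    · have := h1.col_ne hB p.1.2 hz
      rw [hp] at this
      show col c z = false
      cases h : col c z
      · rfl
      · exact absurd h.symm this
    · rintro y ⟨k1, k2⟩
      rcases unique hB y.1.2 hz p.1.2 q.1.2 k1 k2 (h1.symm hB) (h2.symm hB) with h | h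
      · exact Subtype.ext (Subtype.ext h)
      · exact absurd h hne
  nondeg := by
    obtain ⟨p, q, r, s, l, m, cp, cq, cr, cs, hpq, hrs, pl, ql, rl, sl, rm, sm, pm, qm⟩ := hB.quad
    have key : ∀ (a b l : B), a ≠ b → adj a l → adj b l → ∀ d : B, ¬ adj d l →
        ∀ z : F c adj, Adj adj (base a) z.1 → Adj adj (base b) z.1 → ¬ Adj adj (base d) z.1 := by
      intro a b l hab hal hbl d hd z h1 h2 h3
      rcases unique hB (Valid.base a) (Valid.base b) z.2 (Valid.base l) h1 (Adj.base_iff.2 hal)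
        h2 (Adj.base_iff.2 hbl) with h | h
      · exact hab (base_inj h)
      · rw [h] at h3
        exact hd (Adj.base_iff.1 h3)
    have inj : ∀ {a b : B} (ha : isPt c adj (fbase a)) (hb : isPt c adj (fbase b)), a ≠ b →
      (⟨fbase a, ha⟩ : {x : F c adj // isPt c adj x}) ≠ ⟨fbase b, hb⟩ := by
      intro a b ha hb hab h
      exact hab (base_inj (congrArg (fun x => x.1.1) h))
    refine ⟨⟨fbase p, cp⟩, ⟨fbase q, cq⟩, ⟨fbase r, cr⟩, ⟨fbase s, cs⟩, inj _ _ hpq,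
      inj _ _ ?_, inj _ _ ?_, inj _ _ ?_, inj _ _ ?_, inj _ _ hrs, ?_⟩
    · rintro rfl; exact rl pl
    · rintro rfl; exact sl pl
    · rintro rfl; exact rl ql
    · rintro rfl; exact sl ql
    · intro M
      exact ⟨fun h => key p q l hpq pl ql r rl M.1 h.1 h.2.1 h.2.2,
        fun h => key p q l hpq pl ql s sl M.1 h.1 h.2.1 h.2.2,
        fun h => key r s m hrs rm sm p pm M.1 h.2.1 h.2.2 h.1,
        fun h => key r s m hrs rm sm q qm M.1 h.2.1 h.2.2 h.1⟩

/-- Rigidity: an automorphism of the free completion comes from an automorphism of the base. -/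
theorem exists_of_aut (hB : GoodBase c adj) (ρ : G →* Equiv.Perm B)
    (hadj : ∀ g x y, adj x y ↔ adj (ρ g x) (ρ g y)) (hcol : ∀ g x, c (ρ g x) = c x)
    (hsurj : ∀ π : Equiv.Perm B, (∀ x y, adj x y ↔ adj (π x) (π y)) → (∀ x, c (π x) = c x) →
      ∃ g, ρ g = π)
    (φ : Equiv.Perm (F c adj)) (h1 : ∀ x y, fadj x y ↔ fadj (φ x) (φ y))
    (h2 : ∀ x, col c (φ x).1 = col c x.1) : ∃ g, actF ρ hadj hcol g = φ := by
  have hb : ∀ b, ∃ b', φ (fbase b) = fbase b' := by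
    intro b
    rw [← conf_iff hB]
    exact Conf.map φ φ.injective (fun x y => (h1 x y).1) ((conf_iff hB _).2 ⟨b, rfl⟩)
  have hb' : ∀ b, ∃ b', φ.symm (fbase b) = fbase b' := by
    intro b
    rw [← conf_iff hB]
    refine Conf.map φ.symm φ.symm.injective (fun x y h => ?_) ((conf_iff hB _).2 ⟨b, rfl⟩)
    rw [h1]; simpa using h
  choose f hf using hb
  choose f' hf' using hb'
  have binj : ∀ {a b : B}, (fbase a : F c adj) = fbase b → a = b :=
    fun h => base_inj (congrArg Subtype.val h)
  let π : Equiv.Perm B :=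
    { toFun := f
      invFun := f'
      left_inv := fun b => binj (by rw [← hf', ← hf, Equiv.symm_apply_apply])
      right_inv := fun b => binj
        (by rw [← hf, ← hf', Equiv.apply_symm_apply]) }
  obtain ⟨g, hg⟩ := hsurj π (by
      intro x y
      have := h1 (fbase x) (fbase y)
      rw [hf, hf] at this
      exact Adj.base_iff.symm.trans (this.trans Adj.base_iff)) (by
      intro x
      have := h2 (fbase x)
      rw [hf] at this
      exact this)
  refine ⟨g, ?_⟩
  have main : ∀ x, ∀ hx : Valid c adj x, map (ρ g) x = (φ ⟨x, hx⟩).1 := by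
    intro x hx
    induction hx with
    | base b =>
      have : (φ ⟨base b, Valid.base b⟩) = fbase (f b) := hf b
      rw [this, hg]
      rfl
    | pair x y hx hy hne hc hz ihx ihy =>
      have hv := Valid.pair x y hx hy hne hc hz
      have e1 : fadj (⟨x, hx⟩ : F c adj) ⟨Q.pair x y, hv⟩ := Or.inr (Or.inr ⟨y, rfl⟩)
      have e2 : fadj (⟨y, hy⟩ : F c adj) ⟨Q.pair x y, hv⟩ :=
        Or.inr (Or.inr ⟨x, pair_comm _ _⟩)
      have k1 := (h1 _ _).1 e1
      have k2 := (h1 _ _).1 e2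
      unfold fadj at k1 k2
      have a1 := adj_map (fun x y => (hadj g x y).1) e1
      have a2 := adj_map (fun x y => (hadj g x y).1) e2
      simp only at a1 a2
      rw [ihx] at a1
      rw [ihy] at a2
      rcases unique hB (φ ⟨x, hx⟩).2 (φ ⟨y, hy⟩).2 (valid_map (hadj g) (hcol g) hv)
        (φ ⟨_, hv⟩).2 a1 k1 a2 k2 with h | h
      · have := φ.injective (Subtype.ext h)
        exact absurd (congrArg Subtype.val this) hne
      · exact h
  apply Equiv.ext
  intro x
  exact Subtype.ext (main x.1 x.2)

theorem main_of_base (hB : GoodBase c adj) (ρ : G →* Equiv.Perm B)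
    (hadj : ∀ g x y, adj x y ↔ adj (ρ g x) (ρ g y)) (hcol : ∀ g x, c (ρ g x) = c x)
    (hinj : Function.Injective ρ)
    (hsurj : ∀ π : Equiv.Perm B, (∀ x y, adj x y ↔ adj (π x) (π y)) → (∀ x, c (π x) = c x) →
      ∃ g, ρ g = π) :
    ∃ (P L : Type u) (I : P → L → Prop),
      IsProjectivePlane I ∧ Nonempty (autGroup I ≃* G) := by
  refine ⟨_, _, inc c adj, plane hB, ?_⟩
  have hp : ∀ g x, isPt c adj (actF ρ hadj hcol g x) ↔ isPt c adj x := by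
    intro g x
    unfold isPt
    rw [actF_val, col_map (hcol g)]
  have hA : ∀ g (x y : F c adj), fadj x y ↔ fadj (actF ρ hadj hcol g x) (actF ρ hadj hcol g y) := by
    have : ∀ g (x y : F c adj), fadj x y →
        fadj (actF ρ hadj hcol g x) (actF ρ hadj hcol g y) :=
      fun g x y h => adj_map (fun x y => (hadj g x y).1) h
    intro g x y
    refine ⟨this g x y, fun h => ?_⟩
    have := this g⁻¹ _ _ h
    rw [map_inv] at this
    simpa using this
  let Φ : G →* autGroup (inc c adj) :=
    { toFun := fun g => ⟨((actF ρ hadj hcol g).subtypePerm (hp g),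
        (actF ρ hadj hcol g).subtypePerm (fun x => not_congr (hp g x))),
        fun p M => hA g p.1 M.1⟩
      map_one' := by
        apply Subtype.ext
        apply Prod.ext <;> ext x <;> simp
      map_mul' := by
        intro g h
        apply Subtype.ext
        apply Prod.ext
        · apply Equiv.ext
          intro x
          apply Subtype.ext
          show actF ρ hadj hcol (g * h) x.1 = _
          rw [map_mul]
          rfl
        · apply Equiv.ext
          intro x
          apply Subtype.ext
          show actF ρ hadj hcol (g * h) x.1 = _
          rw [map_mul]
          rfl }
  refine ⟨(MulEquiv.ofBijective Φ ⟨?_, ?_⟩).symm⟩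
  · intro g h hgh
    apply hinj
    have e : ∀ x : F c adj, actF ρ hadj hcol g x = actF ρ hadj hcol h x := by
      intro x
      have h1 := congrArg (fun z => z.1.1) hgh
      have h2 := congrArg (fun z => z.1.2) hgh
      by_cases hx : isPt c adj x
      · exact congrArg Subtype.val (DFunLike.congr_fun h1 ⟨x, hx⟩)
      · exact congrArg Subtype.val (DFunLike.congr_fun h2 ⟨x, hx⟩)
    ext b
    exact base_inj (congrArg Subtype.val (e (fbase b)))
  · rintro ⟨⟨σ, τ⟩, hστ⟩
    let φ : Equiv.Perm (F c adj) := Equiv.Perm.subtypeCongr σ τ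
    have hl : ∀ x (hx : isPt c adj x), φ x = (σ ⟨x, hx⟩).1 := fun x hx =>
      Equiv.Perm.subtypeCongr.left_apply σ τ hx
    have hr : ∀ x (hx : ¬ isPt c adj x), φ x = (τ ⟨x, hx⟩).1 := fun x hx =>
      Equiv.Perm.subtypeCongr.right_apply σ τ hx
    have hpt : ∀ x, isPt c adj (φ x) ↔ isPt c adj x := by
      intro x
      by_cases hx : isPt c adj x
      · rw [hl x hx]; exact iff_of_true (σ ⟨x, hx⟩).2 hx
      · rw [hr x hx]; exact iff_of_false (τ ⟨x, hx⟩).2 hx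
    have hnn : ∀ x y : F c adj, fadj x y → (isPt c adj x ↔ ¬ isPt c adj y) := by
      intro x y h
      have := Adj.col_ne hB x.2 y.2 h
      unfold isPt
      revert this
      cases col c x.1 <;> cases col c y.1 <;> simp
    have hlr : ∀ x y : F c adj, isPt c adj x → ¬ isPt c adj y → (fadj x y ↔ fadj (φ x) (φ y)) := by
      intro x y hx hy
      rw [hl x hx, hr y hy]
      exact hστ ⟨x, hx⟩ ⟨y, hy⟩
    have hsy : ∀ x y : F c adj, fadj x y ↔ fadj y x := fun x y =>
      ⟨fun h => Adj.symm hB h, fun h => Adj.symm hB h⟩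
    obtain ⟨g, hg⟩ := exists_of_aut hB ρ hadj hcol hsurj φ (by
        intro x y
        by_cases hx : isPt c adj x <;> by_cases hy : isPt c adj y
        · refine iff_of_false (fun h => ?_) (fun h => ?_)
          · exact (hnn _ _ h).1 hx hy
          · exact (hnn _ _ h).1 ((hpt x).2 hx) ((hpt y).2 hy)
        · exact hlr x y hx hy
        · rw [hsy x y, hsy (φ x)]; exact hlr y x hy hx
        · refine iff_of_false (fun h => ?_) (fun h => ?_)
          · exact hx ((hnn _ _ h).2 hy)
          · exact hx ((hpt x).1 ((hnn _ _ h).2 (fun h => hy ((hpt y).1 h))))) (by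
        intro x
        have := hpt x
        unfold isPt at this
        revert this
        cases col c x.1 <;> cases col c (φ x).1 <;> simp)
    refine ⟨g, ?_⟩
    apply Subtype.ext
    apply Prod.ext
    · apply Equiv.ext
      intro x
      apply Subtype.ext
      show actF ρ hadj hcol g x.1 = (σ x).1
      rw [hg, hl x.1 x.2]
    · apply Equiv.ext
      intro x
      apply Subtype.ext
      show actF ρ hadj hcol g x.1 = (τ x).1
      rw [hg, hr x.1 x.2]

end

end FreePlane

namespace FreePlane

/-- The neighbour lists of a rigid configuration with points `0..9` and lines `10..19`. -/
def N : Fin 20 → List (Fin 20) :=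
  ![[11, 12, 17], [10, 15, 18], [13, 14, 18, 19], [10, 12, 13],
    [11, 13, 16], [11, 14, 15], [10, 14, 16, 17], [12, 16, 18],
    [15, 17, 19], [10, 11, 19], [1, 3, 6, 9], [0, 4, 5, 9],
    [0, 3, 7], [2, 3, 4], [2, 5, 6], [1, 5, 8],
    [4, 6, 7], [0, 6, 8], [1, 2, 7], [2, 8, 9]]

def kcol (z : Fin 20) : Bool := decide (10 ≤ z)

theorem N_symm : ∀ z, ∀ w ∈ N z, z ∈ N w := by decide +kernel

theorem N_col : ∀ z, ∀ w ∈ N z, kcol z ≠ kcol w := by decide +kernel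

theorem N_nodup : ∀ z, (N z).Nodup := by decide +kernel

theorem N_c4 : ∀ a, ∀ x ∈ N a, ∀ y ∈ N a, x ≠ y → ∀ b ∈ N x, b ∈ N y → a = b := by
  decide +kernel

theorem N_three : ∀ z, ∃ y₁ ∈ N z, ∃ y₂ ∈ N z, ∃ y₃ ∈ N z, y₁ ≠ y₂ ∧ y₁ ≠ y₃ ∧ y₂ ≠ y₃ := by
  decide +kernel

theorem N_hex : ∀ u, ∀ v ∈ N u, ∃ w₁ ∈ N v, u ≠ w₁ ∧ ∃ w₂ ∈ N w₁, v ≠ w₂ ∧ ∃ w₃ ∈ N w₂,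
    w₁ ≠ w₃ ∧ w₃ ≠ u ∧ ∃ w₄ ∈ N w₃, w₂ ≠ w₄ ∧ w₄ ≠ v ∧ u ∈ N w₄ := by
  set_option synthInstance.maxHeartbeats 400000 in
  set_option synthInstance.maxSize 2000 in
  decide +kernel

theorem N_conn : ∀ z, ∃ x₁ ∈ N 7, ∃ x₂ ∈ N x₁, ∃ x₃ ∈ N x₂, ∃ x₄ ∈ N x₃, z = x₄ ∨ z ∈ N x₄ := by
  decide +kernel

/-- The iterated degree invariant. -/
def hinv : ℕ → Fin 20 → ℕ
  | 0, z => (N z).length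
  | k + 1, z => ((N z).map (fun w => hinv k w ^ 2)).sum

theorem hinv_inj : ∀ z w, kcol z = kcol w → hinv 3 z = hinv 3 w → z = w := by decide +kernel

theorem N_rigid (f : Fin 20 → Fin 20) (hf : Function.Injective f)
    (h : ∀ z w, w ∈ N z ↔ f w ∈ N (f z)) (hc : ∀ z, kcol (f z) = kcol z) (z : Fin 20) :
    f z = z := by
  have hs := Finite.surjective_of_injective hf
  have hp : ∀ z, (N (f z)).Perm ((N z).map f) := by
    intro z
    rw [List.perm_ext_iff_of_nodup (N_nodup _) ((N_nodup z).map hf)]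
    intro w
    obtain ⟨w, rfl⟩ := hs w
    rw [← h, List.mem_map_of_injective hf]
  have hk : ∀ k z, hinv k (f z) = hinv k z := by
    intro k
    induction k with
    | zero => intro z; simpa [hinv] using (hp z).length_eq
    | succ k ih =>
      intro z
      have := ((hp z).map (fun w => hinv k w ^ 2)).sum_eq
      rw [List.map_map] at this
      simp only [hinv, this]
      congr 2
      funext w
      simp [ih]
  exact hinv_inj _ _ (hc z) (hk 3 z)

/-- The positions at which a relation copy is attached. -/
def port : Fin 6 → Fin 20 := ![10, 11, 13, 14, 15, 17]

theorem port_inj : ∀ i j, port i = port j → i = j := by decide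
theorem port_col : ∀ i, kcol (port i) = true := by decide
theorem port_not : ∀ i, (7 : Fin 20) ∉ N (port i) := by decide +kernel

/-- The index set of the copies of the configuration. -/
inductive Om (G : Type u) : Type u
  | V : G → Om G
  | C : G → Om G
  | L : G → G → Om G
  | M : G → G → Om G

/-- The labelled relation that encodes the group. -/
inductive A {G : Type u} [Group G] (r : G → G → Prop) : Fin 6 → Om G → Om G → Prop
  | l0 (x s : G) : A r 0 (Om.L x s) (Om.V x)
  | l1 (x s : G) : A r 1 (Om.L x s) (Om.C s)
  | l2 (x s : G) : s ≠ 1 → A r 2 (Om.L x s) (Om.V (x * s))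
  | m3 (s t : G) : A r 3 (Om.M s t) (Om.C s)
  | m4 (s t : G) : r s t → A r 4 (Om.M s t) (Om.C t)
  | m5 (s t : G) : r t s → A r 5 (Om.M s t) (Om.C t)

section
variable {G : Type u} [Group G] {r : G → G → Prop}

def isRel : Om G → Bool
  | Om.V _ => false
  | Om.C _ => false
  | Om.L _ _ => true
  | Om.M _ _ => true

theorem A.rel {i : Fin 6} {e o : Om G} (h : A r i e o) : isRel e = true ∧ isRel o = false := by
  cases h <;> exact ⟨rfl, rfl⟩

theorem A.fn {i : Fin 6} {e o p : Om G} (h : A r i e o) (h2 : A r i e p) : o = p := by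
  cases h <;> cases h2 <;> rfl

theorem A.one [IsWellOrder G r] {i j : Fin 6} {e o : Om G} (h : A r i e o) (h2 : A r j e o) :
    i = j := by
  generalize ho : o = o' at h2
  cases h <;> cases h2 <;> simp_all
  all_goals first
    | (exact absurd ‹r _ _› (irrefl_of r _))
    | (exact absurd ‹r _ _› (asymm_of r ‹r _ _›))

/-- The base configuration. -/
inductive BAdj (r : G → G → Prop) : Om G × Fin 20 → Om G × Fin 20 → Prop
  | inner (e : Om G) (z w : Fin 20) : w ∈ N z → BAdj r (e, z) (e, w)
  | out (i : Fin 6) (e o : Om G) : A r i e o → BAdj r (e, port i) (o, 7)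
  | out' (i : Fin 6) (e o : Om G) : A r i e o → BAdj r (o, 7) (e, port i)

def bcol (x : Om G × Fin 20) : Bool := kcol x.2

theorem BAdj.symm {x y : Om G × Fin 20} (h : BAdj r x y) : BAdj r y x := by
  cases h with
  | inner e z w h => exact BAdj.inner e w z (N_symm _ _ h)
  | out i e o h => exact BAdj.out' i e o h
  | out' i e o h => exact BAdj.out i e o h

theorem BAdj.col_ne {x y : Om G × Fin 20} (h : BAdj r x y) : bcol x ≠ bcol y := by
  cases h with
  | inner e z w h => exact N_col _ _ h
  | out i e o h => simp only [bcol, port_col]; decide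
  | out' i e o h => simp only [bcol, port_col]; decide

theorem BAdj.relCase {e : Om G} (he : isRel e = true) {z : Fin 20} {y : Om G × Fin 20}
    (h : BAdj r (e, z) y) :
    (∃ w ∈ N z, y = (e, w)) ∨ ∃ i o, z = port i ∧ y = (o, 7) ∧ A r i e o := by
  generalize hx : (e, z) = x at h
  cases h with
  | inner e' z' w h => cases hx; exact Or.inl ⟨w, h, rfl⟩
  | out i e' o h => cases hx; exact Or.inr ⟨i, o, rfl, rfl, h⟩
  | out' i e' o h => cases hx; rw [h.rel.2] at he; cases he

theorem BAdj.objCase {e : Om G} (he : isRel e = false) {z : Fin 20} {y : Om G × Fin 20}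
    (h : BAdj r (e, z) y) :
    (∃ w ∈ N z, y = (e, w)) ∨ ∃ i o, z = 7 ∧ y = (o, port i) ∧ A r i o e := by
  generalize hx : (e, z) = x at h
  cases h with
  | inner e' z' w h => cases hx; exact Or.inl ⟨w, h, rfl⟩
  | out i e' o h => cases hx; rw [h.rel.1] at he; cases he
  | out' i e' o h => cases hx; exact Or.inr ⟨i, e', rfl, rfl, h⟩

theorem BAdj.inner_iff {e : Om G} {z w : Fin 20} : BAdj r (e, z) (e, w) ↔ w ∈ N z := by
  constructor
  · intro h
    generalize hx : (e, z) = x at h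
    generalize hy : (e, w) = y at h
    cases h with
    | inner e' z' w h => cases hx; cases hy; exact h
    | out i e' o h =>
      cases hx; cases hy
      have := h.rel
      rw [this.1] at this
      cases this.2
    | out' i e' o h =>
      cases hx; cases hy
      have := h.rel
      rw [this.1] at this
      cases this.2
  · exact BAdj.inner e z w

theorem BAdj.port_iff {i : Fin 6} {e o : Om G} : BAdj r (e, port i) (o, 7) ↔ A r i e o := by
  constructor
  · intro h
    generalize hx : (e, port i) = x at h
    generalize hy : (o, (7 : Fin 20)) = y at h
    cases h with
    | inner e' z' w h => cases hx; cases hy; exact absurd h (port_not i)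
    | out j e' o h =>
      obtain ⟨rfl, hx'⟩ := Prod.mk.inj hx
      cases hy
      rw [port_inj _ _ hx']; exact h
    | out' j e' o h =>
      obtain ⟨rfl, hx'⟩ := Prod.mk.inj hx
      have := port_col i
      rw [hx'] at this
      exact absurd this (by decide)
  · exact BAdj.out i e o

/-- A relation copy and a neighbour of its port: the next step stays inside. -/
theorem stay {i : Fin 6} {e : Om G} (he : isRel e = true) {z : Fin 20} (hz : z ∈ N (port i))
    {y : Om G × Fin 20} (h : BAdj r (e, z) y) : ∃ w ∈ N z, y = (e, w) := by
  rcases h.relCase he with h | ⟨j, o, rfl, _, _⟩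
  · exact h
  · have := N_col _ _ hz
    rw [port_col, port_col] at this
    exact absurd rfl this

theorem cross4 [IsWellOrder G r] {i : Fin 6} {e o : Om G} (h : A r i e o)
    {v w : Om G × Fin 20} (h1 : BAdj r (o, 7) v) (h2 : BAdj r v w)
    (h3 : BAdj r w (e, port i)) : v = (e, port i) ∨ w = (o, 7) := by
  rcases h3.symm.relCase h.rel.1 with ⟨z, hz, rfl⟩ | ⟨j, p, hj, rfl, hp⟩
  · left
    obtain ⟨z', hz', rfl⟩ := stay h.rel.1 hz h2.symm
    rcases h1.objCase h.rel.2 with ⟨z2, _, h5⟩ | ⟨j, e', _, h5, hA⟩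
    · have h6 := h.rel
      rw [(Prod.mk.inj h5).1, (h.rel).2] at h6
      cases h6.1
    · obtain ⟨rfl, rfl⟩ := Prod.mk.inj h5
      rw [hA.one h]
  · right
    rw [port_inj _ _ hj] at h
    rw [hp.fn h]

theorem b_c4 [IsWellOrder G r] {a b x y : Om G × Fin 20} (h1 : BAdj r a x) (h2 : BAdj r a y)
    (h3 : BAdj r b x) (h4 : BAdj r b y) : a = b ∨ x = y := by
  have key : ∀ {a b x y : Om G × Fin 20}, BAdj r a x → BAdj r a y → BAdj r b x → BAdj r b y →
      a = b ∨ x = y ∨ (a.1 = x.1 ∧ x.2 ∈ N a.2) := by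
    intro a b x y h1 h2 h3 h4
    cases h1 with
    | inner e z w h => exact Or.inr (Or.inr ⟨rfl, h⟩)
    | out i e o h =>
      rcases cross4 h h3.symm h4 h2.symm with h | h
      · exact Or.inl h.symm
      · exact Or.inr (Or.inl h.symm)
    | out' i e o h =>
      rcases cross4 h h2 h4.symm h3 with h | h
      · exact Or.inr (Or.inl h.symm)
      · exact Or.inl h.symm
  rcases key h1 h2 h3 h4 with h | h | ⟨k1, m1⟩
  · exact Or.inl h
  · exact Or.inr h
  rcases key h2 h1 h4 h3 with h | h | ⟨k2, m2⟩
  · exact Or.inl h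
  · exact Or.inr h.symm
  rcases key h3 h4 h1 h2 with h | h | ⟨k3, m3⟩
  · exact Or.inl h.symm
  · exact Or.inr h
  rcases key h4 h3 h2 h1 with h | h | ⟨k4, m4⟩
  · exact Or.inl h.symm
  · exact Or.inr h.symm
  by_cases hxy : x.2 = y.2
  · exact Or.inr (Prod.ext (k1.symm.trans k2) hxy)
  · exact Or.inl (Prod.ext (k1.trans k3.symm)
      (N_c4 _ _ m1 _ m2 hxy _ (N_symm _ _ m3) (N_symm _ _ m4)))

/-- The edge `u v` lies on a hexagon. -/
def Hex {X : Type u} (adj : X → X → Prop) (u v : X) : Prop :=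
  ∃ w₁ w₂ w₃ w₄, adj v w₁ ∧ adj w₁ w₂ ∧ adj w₂ w₃ ∧ adj w₃ w₄ ∧ adj w₄ u ∧
    u ≠ w₁ ∧ v ≠ w₂ ∧ w₁ ≠ w₃ ∧ w₂ ≠ w₄ ∧ w₃ ≠ u ∧ w₄ ≠ v

theorem Hex.map {X : Type u} {adj : X → X → Prop} (f : X → X) (hf : Function.Injective f)
    (h : ∀ x y, adj x y → adj (f x) (f y)) {u v : X} (hh : Hex adj u v) :
    Hex adj (f u) (f v) := by
  obtain ⟨w₁, w₂, w₃, w₄, a1, a2, a3, a4, a5, n1, n2, n3, n4, n5, n6⟩ := hh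
  exact ⟨f w₁, f w₂, f w₃, f w₄, h _ _ a1, h _ _ a2, h _ _ a3, h _ _ a4, h _ _ a5, hf.ne n1,
    hf.ne n2, hf.ne n3, hf.ne n4, hf.ne n5, hf.ne n6⟩

theorem hex_inner (e : Om G) {z w : Fin 20} (h : w ∈ N z) : Hex (BAdj r) (e, z) (e, w) := by
  obtain ⟨w₁, a1, n1, w₂, a2, n2, w₃, a3, n3, n5, w₄, a4, n4, n6, a5⟩ := N_hex z w h
  refine ⟨(e, w₁), (e, w₂), (e, w₃), (e, w₄), .inner _ _ _ a1, .inner _ _ _ a2, .inner _ _ _ a3,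
    .inner _ _ _ a4, .inner _ _ _ a5, ?_, ?_, ?_, ?_, ?_, ?_⟩ <;>
  · intro h
    have := (Prod.mk.inj h).2
    contradiction

theorem not_hex [IsWellOrder G r] {i : Fin 6} {e o : Om G} (h : A r i e o) :
    ¬ Hex (BAdj r) (e, port i) (o, 7) := by
  have heo : e ≠ o := by
    rintro rfl
    have := h.rel
    rw [this.1] at this
    cases this.2
  rintro ⟨w₁, w₂, w₃, w₄, a1, a2, a3, a4, a5, n1, n2, n3, n4, n5, n6⟩
  rcases a5.symm.relCase h.rel.1 with ⟨z, hz, rfl⟩ | ⟨j, p, hj, rfl, hp⟩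
  swap
  · rw [port_inj _ _ hj] at h
    rw [hp.fn h] at n6
    exact n6 rfl
  obtain ⟨z', hz', rfl⟩ := stay h.rel.1 hz a4.symm
  rcases a3.symm.relCase h.rel.1 with ⟨z2, hz2, rfl⟩ | ⟨j, p, rfl, rfl, hp⟩
  · rcases a1.objCase h.rel.2 with ⟨z3, hz3, rfl⟩ | ⟨j, e', _, rfl, hA⟩
    · rcases a2.objCase h.rel.2 with ⟨_, _, h5⟩ | ⟨_, _, rfl, _, _⟩
      · exact heo (Prod.mk.inj h5).1
      · exact N_col _ _ hz3 rfl
    · rcases a2.relCase hA.rel.1 with ⟨_, _, h5⟩ | ⟨_, p, _, h5, hp⟩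
      · obtain ⟨rfl, _⟩ := Prod.mk.inj h5
        rw [hA.one h] at n1
        exact n1 rfl
      · have := hp.rel.2
        rw [← (Prod.mk.inj h5).1, h.rel.1] at this
        cases this
  · have hop : o ≠ p := by
      rintro rfl
      exact n2 rfl
    rcases a1.objCase h.rel.2 with ⟨z3, hz3, rfl⟩ | ⟨j', e', _, rfl, hA⟩
    · rcases a2.objCase h.rel.2 with ⟨_, _, h5⟩ | ⟨_, _, rfl, _, _⟩
      · exact hop (Prod.mk.inj h5).1.symm
      · exact N_col _ _ hz3 rfl
    · have hA' := BAdj.port_iff.1 a2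
      exact hop (hA.fn hA')

theorem same_copy [IsWellOrder G r] (φ : Equiv.Perm (Om G × Fin 20))
    (h : ∀ x y, BAdj r x y → BAdj r (φ x) (φ y)) (e : Om G) (z : Fin 20) :
    (φ (e, z)).1 = (φ (e, 7)).1 := by
  have step : ∀ z, ∀ w ∈ N z, (φ (e, w)).1 = (φ (e, z)).1 := by
    intro z w hw
    have h1 := (hex_inner (r := r) e hw).map φ φ.injective h
    have h2 := (hex_inner (r := r) e (N_symm _ _ hw)).map φ φ.injective h
    have h3 := h _ _ (BAdj.inner e z w hw)
    generalize φ (e, z) = x at *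
    generalize φ (e, w) = y at *
    cases h3 with
    | inner => rfl
    | out i e o hA => exact absurd h1 (not_hex hA)
    | out' i e o hA => exact absurd h2 (not_hex hA)
  obtain ⟨x₁, m1, x₂, m2, x₃, m3, x₄, m4, h5⟩ := N_conn z
  have h4 : (φ (e, x₄)).1 = (φ (e, 7)).1 := by
    rw [step _ _ m4, step _ _ m3, step _ _ m2, step _ _ m1]
  rcases h5 with rfl | h5
  · exact h4
  · rw [step _ _ h5, h4]

theorem exists_perm [IsWellOrder G r] (φ : Equiv.Perm (Om G × Fin 20))
    (h : ∀ x y, BAdj r x y ↔ BAdj r (φ x) (φ y)) (hc : ∀ x, bcol (φ x) = bcol x) :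
    ∃ π : Equiv.Perm (Om G), (∀ e z, φ (e, z) = (π e, z)) ∧
      ∀ i e o, A r i e o ↔ A r i (π e) (π o) := by
  have h' : ∀ x y, BAdj r x y → BAdj r (φ.symm x) (φ.symm y) := by
    intro x y hh
    rw [h]; simpa using hh
  have s1 := same_copy φ (fun x y => (h x y).1)
  have s2 := same_copy φ.symm h'
  let π : Equiv.Perm (Om G) :=
    { toFun := fun e => (φ (e, 7)).1
      invFun := fun e => (φ.symm (e, 7)).1
      left_inv := fun e => by
        have := s2 (φ (e, 7)).1 (φ (e, 7)).2
        simp only [Prod.mk.eta, Equiv.symm_apply_apply] at this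
        exact this.symm
      right_inv := fun e => by
        have := s1 (φ.symm (e, 7)).1 (φ.symm (e, 7)).2
        simp only [Prod.mk.eta, Equiv.apply_symm_apply] at this
        exact this.symm }
  have hπ : ∀ e z, φ (e, z) = (π e, z) := by
    intro e z
    have h0 : ∀ z, φ (e, z) = (π e, (φ (e, z)).2) := fun z => Prod.ext (s1 e z) rfl
    have := N_rigid (fun z => (φ (e, z)).2) (by
        intro z w hzw
        simp only at hzw
        have : φ (e, z) = φ (e, w) := by rw [h0 z, h0 w, hzw]
        exact (Prod.mk.inj (φ.injective this)).2) (by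
        intro z w
        rw [← BAdj.inner_iff (r := r) (e := e), h, h0 z, h0 w, BAdj.inner_iff]) (by
        intro z
        exact hc (e, z)) z
    rw [h0 z]
    exact Prod.ext rfl this
  refine ⟨π, hπ, fun i e o => ?_⟩
  rw [← BAdj.port_iff, h, hπ, hπ, BAdj.port_iff]

/-- The action of `G` on the index set. -/
def actO (g : G) : Om G → Om G
  | Om.V x => Om.V (g * x)
  | Om.C s => Om.C s
  | Om.L x s => Om.L (g * x) s
  | Om.M s t => Om.M s t

theorem actO_one (e : Om G) : actO 1 e = e := by cases e <;> simp [actO]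
theorem actO_mul (g h : G) (e : Om G) : actO (g * h) e = actO g (actO h e) := by
  cases e <;> simp [actO, mul_assoc]

theorem actO_A (g : G) {i : Fin 6} {e o : Om G} (h : A r i e o) :
    A r i (actO g e) (actO g o) := by
  cases h with
  | l0 x s => exact A.l0 _ _
  | l1 x s => exact A.l1 _ _
  | l2 x s hs => simp only [actO, ← mul_assoc]; exact A.l2 _ _ hs
  | m3 s t => exact A.m3 _ _
  | m4 s t h => exact A.m4 _ _ h
  | m5 s t h => exact A.m5 _ _ h

def actB : G →* Equiv.Perm (Om G × Fin 20) where
  toFun g :=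
    { toFun := fun x => (actO g x.1, x.2)
      invFun := fun x => (actO g⁻¹ x.1, x.2)
      left_inv := fun x => by simp [← actO_mul, actO_one]
      right_inv := fun x => by simp [← actO_mul, actO_one] }
  map_one' := by
    apply Equiv.ext
    intro x
    simp [actO_one]
  map_mul' g h := by
    apply Equiv.ext
    intro x
    simp [actO_mul]

theorem actB_apply (g : G) (x : Om G × Fin 20) : actB g x = (actO g x.1, x.2) := rfl

theorem actB_adj' (g : G) {x y : Om G × Fin 20} (h : BAdj r x y) :
    BAdj r (actB g x) (actB g y) := by
  cases h with
  | inner e z w h => exact BAdj.inner _ _ _ h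
  | out i e o h => exact BAdj.out _ _ _ (actO_A g h)
  | out' i e o h => exact BAdj.out' _ _ _ (actO_A g h)

theorem actB_adj (g : G) (x y : Om G × Fin 20) :
    BAdj r x y ↔ BAdj r (actB g x) (actB g y) := by
  refine ⟨actB_adj' g, fun h => ?_⟩
  have := actB_adj' g⁻¹ h
  rw [map_inv] at this
  simpa using this

theorem om_rigid [IsWellOrder G r] (π : Equiv.Perm (Om G))
    (h : ∀ i e o, A r i e o ↔ A r i (π e) (π o)) : ∃ g, ∀ e, π e = actO g e := by
  have hV : ∀ x, ∃ y, π (Om.V x) = Om.V y := by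
    intro x
    have := (h _ _ _).1 (A.l0 x 1)
    generalize π (Om.V x) = o at *
    generalize π (Om.L x 1) = e at *
    cases this
    exact ⟨_, rfl⟩
  have hC : ∀ x, ∃ y, π (Om.C x) = Om.C y := by
    intro x
    have := (h _ _ _).1 (A.l1 1 x)
    generalize π (Om.C x) = o at *
    generalize π (Om.L 1 x) = e at *
    cases this
    exact ⟨_, rfl⟩
  choose f hf using hV
  choose p hp using hC
  have hL : ∀ x s, π (Om.L x s) = Om.L (f x) (p s) := by
    intro x s
    have h0 := (h _ _ _).1 (A.l0 x s)
    have h1 := (h _ _ _).1 (A.l1 x s)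
    rw [hf] at h0
    rw [hp] at h1
    generalize π (Om.L x s) = o at *
    cases h0
    cases h1
    rfl
  have hM0 : ∀ s t, ∃ t', π (Om.M s t) = Om.M (p s) t' := by
    intro s t
    have h0 := (h _ _ _).1 (A.m3 s t)
    rw [hp] at h0
    generalize π (Om.M s t) = o at *
    cases h0
    exact ⟨_, rfl⟩
  have hM4 : ∀ s t, r s t → π (Om.M s t) = Om.M (p s) (p t) ∧ r (p s) (p t) := by
    intro s t hst
    have h0 := (h _ _ _).1 (A.m4 s t hst)
    obtain ⟨t', ht⟩ := hM0 s t
    rw [hp, ht] at h0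
    rw [ht]
    cases h0 with
    | m4 _ _ h => exact ⟨rfl, h⟩
  have hM5 : ∀ s t, r t s → π (Om.M s t) = Om.M (p s) (p t) := by
    intro s t hst
    have h0 := (h _ _ _).1 (A.m5 s t hst)
    obtain ⟨t', ht⟩ := hM0 s t
    rw [hp, ht] at h0
    rw [ht]
    cases h0 with
    | m5 _ _ h => rfl
  have hMs : ∀ s, π (Om.M s s) = Om.M (p s) (p s) := by
    intro s
    obtain ⟨t', ht⟩ := hM0 s s
    rw [ht]
    obtain ⟨o, ho⟩ := π.surjective (Om.C t')
    rcases trichotomous_of r (p s) t' with hr | hr | hr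
    · have h0 := A.m4 _ _ hr
      rw [← ht, ← ho, ← h] at h0
      cases h0 with
      | m4 _ _ h => exact absurd h (irrefl_of r s)
    · rw [hr]
    · have h0 := A.m5 _ _ hr
      rw [← ht, ← ho, ← h] at h0
      cases h0 with
      | m5 _ _ h => exact absurd h (irrefl_of r s)
  have hM : ∀ s t, π (Om.M s t) = Om.M (p s) (p t) := by
    intro s t
    rcases trichotomous_of r s t with hr | hr | hr
    · exact (hM4 s t hr).1
    · rw [hr]; exact hMs t
    · exact hM5 s t hr
  have psurj : Function.Surjective p := by
    intro t
    obtain ⟨o, ho⟩ := π.surjective (Om.C t)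
    obtain ⟨e, he⟩ := π.surjective (Om.L 1 t)
    have h0 := A.l1 (r := r) 1 t
    rw [← ho, ← he, ← h] at h0
    cases h0 with
    | l1 x s =>
      rw [hp] at ho
      exact ⟨s, Om.C.inj ho⟩
  let emb : r ↪r r := RelEmbedding.ofMonotone p (fun s t hst => (hM4 s t hst).2)
  have hemb : (RelIso.ofSurjective emb psurj).toInitialSeg = InitialSeg.refl r :=
    Subsingleton.elim _ _
  have hp1 : ∀ s, p s = s := fun s => DFunLike.congr_fun hemb s
  have hmul : ∀ x s, f (x * s) = f x * s := by
    intro x s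
    by_cases hs : s = 1
    · rw [hs, mul_one, mul_one]
    · have h0 := (h _ _ _).1 (A.l2 x s hs)
      rw [hL, hf, hp1] at h0
      generalize f (x * s) = y at *
      cases h0
      rfl
  have hf1 : ∀ x, f x = f 1 * x := by
    intro x
    have := hmul 1 x
    rwa [one_mul] at this
  refine ⟨f 1, fun e => ?_⟩
  cases e with
  | V x => rw [hf, hf1]; rfl
  | C s => rw [hp, hp1]; rfl
  | L x s => rw [hL, hf1, hp1]; rfl
  | M s t => rw [hM, hp1, hp1]; rfl

theorem goodBase [IsWellOrder G r] : GoodBase (B := Om G × Fin 20) bcol (BAdj r) where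
  symm := BAdj.symm
  col_ne := BAdj.col_ne
  c4 := b_c4
  conf := by
    rintro ⟨e, z⟩
    refine ⟨Set.range (fun w => (e, w)), Set.finite_range _, ⟨z, rfl⟩, ?_⟩
    rintro _ ⟨w, rfl⟩
    obtain ⟨y₁, m1, y₂, m2, y₃, m3, n1, n2, n3⟩ := N_three w
    have hi : Function.Injective (fun w : Fin 20 => (e, w)) := fun a b h => (Prod.mk.inj h).2
    exact ⟨_, ⟨y₁, rfl⟩, _, ⟨y₂, rfl⟩, _, ⟨y₃, rfl⟩, hi.ne n1, hi.ne n2, hi.ne n3,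
      .inner _ _ _ m1, .inner _ _ _ m2, .inner _ _ _ m3⟩
  quad := by
    refine ⟨(Om.V 1, 1), (Om.V 1, 3), (Om.V 1, 2), (Om.V 1, 8), (Om.V 1, 10), (Om.V 1, 19),
      rfl, rfl, rfl, rfl, ?_, ?_, ?_⟩
    · intro h; exact absurd (Prod.mk.inj h).2 (by decide)
    · intro h; exact absurd (Prod.mk.inj h).2 (by decide)
    · simp only [BAdj.inner_iff]
      decide +kernel

end

end FreePlane

/-- Mendelsohn: for every group `G` there exists a projective plane whose full
automorphism group is isomorphic to `G`. -/
theorem exists_projective_plane_with_automorphism_group (G : Type u) [Group G] :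
    ∃ (P L : Type u) (I : P → L → Prop),
      IsProjectivePlane I ∧ Nonempty (autGroup I ≃* G) := by
  exact FreePlane.main_of_base (FreePlane.goodBase (r := WellOrderingRel)) FreePlane.actB
    FreePlane.actB_adj (fun _ _ => rfl) (by
      intro g h hgh
      have := DFunLike.congr_fun hgh (FreePlane.Om.V 1, 7)
      simpa [FreePlane.actB_apply, FreePlane.actO] using this) (by
      intro φ h hc
      obtain ⟨π, h1, h2⟩ := FreePlane.exists_perm φ h hc
      obtain ⟨g, hg⟩ := FreePlane.om_rigid π h2
      refine ⟨g, ?_⟩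
      apply Equiv.ext
      rintro ⟨e, z⟩
      rw [h1, hg]
      rfl)
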